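/- For the weight w(x,t) = x^α(1-x)^β|x-t|^γ(A+Bθ(x-t)) on [0,1] with t ∈ (0,1), the squared norm h_n(t) of the monic orthogonal polynomial P_n satisfies t (d/dt) ln h_n(t) = t x_n(t) − t R_n(t), where x_n and R_n are as above; combined with the sum rule (t−1)R_n − t x_n + α+β+γ+2n+1 = 0 this gives t (d/dt) ln h_n(t) = α + β + γ + 2n + 1 − R_n(t). -/

import Mathlib

open MeasureTheory Polynomial

/-- Expansion of a polynomial of degree `< n` in a monic orthogonal family. -/
theorem eq_sum_of_orthogonal (L : ℝ[X] →ₗ[ℝ] ℝ) (p : ℕ → ℝ[X]) (η : ℕ → ℝ)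
    (hmonic : ∀ k, (p k).Monic) (hdeg : ∀ k, (p k).natDegree = k)
    (horth : ∀ m k, L (p m * p k) = if m = k then η k else 0) (hη : ∀ k, η k ≠ 0)
    (n : ℕ) (q : ℝ[X]) (hq : q.degree < n) :
    q = ∑ k ∈ Finset.range n, C (L (q * p k) / η k) * p k := by
  induction n generalizing q with
  | zero => simpa [Polynomial.degree_lt_iff_coeff_zero, Polynomial.ext_iff] using hq
  | succ n ih =>
    have hpn : (p n).coeff n = 1 := by
      have := hmonic n
      rwa [Monic, leadingCoeff, hdeg] at this
    have hr : (q - C (q.coeff n) * p n).degree < n := by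
      rw [degree_lt_iff_coeff_zero] at hq ⊢
      intro m hm
      rcases hm.eq_or_lt with rfl | hm
      · simp [hpn]
      · rw [coeff_sub, coeff_C_mul, hq m hm,
          coeff_eq_zero_of_natDegree_lt ((hdeg n).trans_lt hm)]
        simp
    have hsum := ih _ hr
    have hL : ∀ k, L ((q - C (q.coeff n) * p n) * p k)
        = L (q * p k) - q.coeff n * if n = k then η k else 0 := by
      intro k
      rw [sub_mul, mul_assoc, C_mul', map_sub, map_smul, horth, smul_eq_mul]
    have hzero : L ((q - C (q.coeff n) * p n) * p n) = 0 := by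
      rw [hsum, Finset.sum_mul, map_sum]
      refine Finset.sum_eq_zero fun k hk => ?_
      rw [mul_assoc, C_mul', map_smul, horth, if_neg (Finset.mem_range.1 hk).ne, smul_zero]
    rw [hL, if_pos rfl, sub_eq_zero] at hzero
    rw [Finset.sum_range_succ, hzero, mul_div_cancel_right₀ _ (hη n), ← sub_eq_iff_eq_add]
    refine hsum.trans (Finset.sum_congr rfl fun k hk => ?_)
    rw [hL, if_neg (Finset.mem_range.1 hk).ne', mul_zero, sub_zero]

theorem map_mul_eq_zero_of_orthogonal (L : ℝ[X] →ₗ[ℝ] ℝ) (p : ℕ → ℝ[X]) (η : ℕ → ℝ)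
    (hmonic : ∀ k, (p k).Monic) (hdeg : ∀ k, (p k).natDegree = k)
    (horth : ∀ m k, L (p m * p k) = if m = k then η k else 0) (hη : ∀ k, η k ≠ 0)
    (n : ℕ) (q : ℝ[X]) (hq : q.degree < n) : L (q * p n) = 0 := by
  rw [eq_sum_of_orthogonal L p η hmonic hdeg horth hη n q hq, Finset.sum_mul, map_sum]
  refine Finset.sum_eq_zero fun k hk => ?_
  rw [mul_assoc, C_mul', map_smul, horth, if_neg (Finset.mem_range.1 hk).ne, smul_zero]

theorem degree_sub_lt_of_monic {p q : ℝ[X]} {n : ℕ} (hp : p.Monic) (hq : q.Monic)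
    (hpn : p.natDegree = n) (hqn : q.natDegree = n) : (p - q).degree < n := by
  have h : p.degree = q.degree := by
    rw [degree_eq_natDegree hp.ne_zero, degree_eq_natDegree hq.ne_zero, hpn, hqn]
  have := degree_sub_lt_left h hp.ne_zero (by rw [hp.leadingCoeff, hq.leadingCoeff])
  rwa [degree_eq_natDegree hp.ne_zero, hpn] at this

theorem map_mul_eq_sum (L : ℝ[X] →ₗ[ℝ] ℝ) {p : ℝ[X]} {n : ℕ} (hp : p.natDegree = n)
    (q : ℝ[X]) : L (p * q) = ∑ j ∈ Finset.range (n + 1), p.coeff j * L (X ^ j * q) := by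
  conv_lhs => rw [p.as_sum_range_C_mul_X_pow, hp, Finset.sum_mul, map_sum]
  refine Finset.sum_congr rfl fun j _ => ?_
  rw [mul_assoc, C_mul', map_smul, smul_eq_mul]

section Family

variable {U : Set ℝ} (L : ℝ → ℝ[X] →ₗ[ℝ] ℝ) (L' : ℝ → ℝ[X] → ℝ)
  (P : ℕ → ℝ → ℝ[X]) (h : ℕ → ℝ → ℝ)

theorem differentiableAt_coeff_of_orthogonal (hU : IsOpen U)
    (hL : ∀ q, ∀ t ∈ U, HasDerivAt (fun s => L s q) (L' t q) t)
    (hmonic : ∀ n, ∀ t ∈ U, (P n t).Monic) (hdeg : ∀ n, ∀ t ∈ U, (P n t).natDegree = n)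
    (horth : ∀ m n, ∀ t ∈ U, L t (P m t * P n t) = if m = n then h n t else 0)
    (hne : ∀ n, ∀ t ∈ U, h n t ≠ 0) (n i : ℕ) {t : ℝ} (ht : t ∈ U) :
    DifferentiableAt ℝ (fun s => (P n s).coeff i) t := by
  induction n using Nat.strong_induction_on generalizing i with
  | _ n ih =>
    have hL₁ : ∀ k < n, ∀ q : ℝ[X], DifferentiableAt ℝ
        (fun s => ∑ j ∈ Finset.range (k + 1), (P k s).coeff j * L s (X ^ j * q)) t := by
      intro k hk q
      exact DifferentiableAt.fun_sum fun j _ =>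
        (ih k hk j).mul (hL _ t ht).differentiableAt
    have hh : ∀ k < n, DifferentiableAt ℝ (h k) t := by
      intro k hk
      have : DifferentiableAt ℝ (fun s => ∑ i ∈ Finset.range (k + 1), (P k s).coeff i *
          ∑ j ∈ Finset.range (k + 1), (P k s).coeff j * L s (X ^ j * X ^ i)) t :=
        DifferentiableAt.fun_sum fun i _ => (ih k hk i).mul (hL₁ k hk _)
      refine this.congr_of_eventuallyEq ?_
      filter_upwards [hU.mem_nhds ht] with s hs
      rw [← if_pos (rfl : k = k) (t := h k s) (e := 0), ← horth k k s hs,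
        map_mul_eq_sum (L s) (hdeg k s hs)]
      refine Finset.sum_congr rfl fun i _ => ?_
      rw [mul_comm (X ^ i), map_mul_eq_sum (L s) (hdeg k s hs)]
    have hmain : DifferentiableAt ℝ (fun s => (X ^ n : ℝ[X]).coeff i -
        ∑ k ∈ Finset.range n, (∑ j ∈ Finset.range (k + 1),
          (P k s).coeff j * L s (X ^ j * X ^ n)) / h k s * (P k s).coeff i) t := by
      refine (differentiableAt_const _).sub (DifferentiableAt.fun_sum fun k hk => ?_)
      have hk := Finset.mem_range.1 hk
      exact ((hL₁ k hk _).div (hh k hk) (hne k t ht)).mul (ih k hk i)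
    refine hmain.congr_of_eventuallyEq ?_
    filter_upwards [hU.mem_nhds ht] with s hs
    have hsum := eq_sum_of_orthogonal (L s) (fun k => P k s) (fun k => h k s)
      (fun k => hmonic k s hs) (fun k => hdeg k s hs) (fun m k => horth m k s hs)
      (fun k => hne k s hs) n (X ^ n - P n s)
      (degree_sub_lt_of_monic (monic_X_pow n) (hmonic n s hs) (natDegree_X_pow n) (hdeg n s hs))
    have hcoeff := congrArg (fun q => q.coeff i) hsum
    simp only [coeff_sub, finsetSum_coeff, coeff_C_mul] at hcoeff
    rw [eq_sub_iff_add_eq, ← eq_sub_iff_add_eq', hcoeff]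
    refine Finset.sum_congr rfl fun k hk => ?_
    rw [sub_mul, map_sub, horth n k s hs, if_neg (Finset.mem_range.1 hk).ne', sub_zero,
      mul_comm (X ^ n), map_mul_eq_sum (L s) (hdeg k s hs)]

/-- If the moment functionals `L s` depend differentiably on `s`, the squared norm of the monic
orthogonal polynomial can be differentiated with the polynomial held fixed. -/
theorem hasDerivAt_norm_of_orthogonal (hU : IsOpen U)
    (hL : ∀ q, ∀ t ∈ U, HasDerivAt (fun s => L s q) (L' t q) t)
    (hmonic : ∀ n, ∀ t ∈ U, (P n t).Monic) (hdeg : ∀ n, ∀ t ∈ U, (P n t).natDegree = n)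
    (horth : ∀ m n, ∀ t ∈ U, L t (P m t * P n t) = if m = n then h n t else 0)
    (hne : ∀ n, ∀ t ∈ U, h n t ≠ 0) (n : ℕ) {t : ℝ} (ht : t ∈ U) :
    HasDerivAt (h n) (L' t (P n t * P n t)) t := by
  set p := P n t
  have hcoeff i := (differentiableAt_coeff_of_orthogonal L L' P h hU hL hmonic hdeg horth hne
    n i ht).hasDerivAt
  have hcross : ∀ s ∈ U, ∀ u ∈ U, L s (P n u * P n s) = h n s := by
    intro s hs u hu
    have h0 := map_mul_eq_zero_of_orthogonal (L s) (fun k => P k s) (fun k => h k s)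
      (fun k => hmonic k s hs) (fun k => hdeg k s hs) (fun m k => horth m k s hs)
      (fun k => hne k s hs) n (P n u - P n s)
      (degree_sub_lt_of_monic (hmonic n u hu) (hmonic n s hs) (hdeg n u hu) (hdeg n s hs))
    rw [sub_mul, map_sub, sub_eq_zero] at h0
    rw [h0, horth n n s hs, if_pos rfl]
  have hvar : HasDerivAt (fun s => h n t + ∑ j ∈ Finset.range (n + 1),
      (P n s).coeff j * (L s (X ^ j * p) - L t (X ^ j * p)))
      (∑ j ∈ Finset.range (n + 1), p.coeff j * L' t (X ^ j * p)) t := by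
    refine (HasDerivAt.fun_sum fun j _ => ?_).const_add _
    exact ((hcoeff j).mul ((hL (X ^ j * p) t ht).sub_const (L t (X ^ j * p)))).congr_deriv
      (by rw [sub_self, mul_zero, zero_add])
  have hfix : HasDerivAt (fun s => L s (p * p))
      (∑ j ∈ Finset.range (n + 1), p.coeff j * L' t (X ^ j * p)) t := by
    rw [funext fun s => map_mul_eq_sum (L s) (hdeg n t ht) p]
    exact HasDerivAt.fun_sum fun j _ => (hL _ t ht).const_mul _
  rw [(hL _ t ht).unique hfix]
  refine hvar.congr_of_eventuallyEq ?_
  filter_upwards [hU.mem_nhds ht] with s hs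
  simp_rw [mul_sub, Finset.sum_sub_distrib, ← map_mul_eq_sum _ (hdeg n s hs)]
  rw [hcross t ht s hs, mul_comm, hcross s hs t ht]
  ring

end Family

/-- The Jacobi weight `x ^ α * (1 - x) ^ β` on `[0, 1]`. -/
noncomputable def jacobiWeight (α β x : ℝ) : ℝ := x ^ α * (1 - x) ^ β

theorem continuous_jacobiWeight {α β : ℝ} (hα : 0 < α) (hβ : 0 < β) :
    Continuous (jacobiWeight α β) := by
  unfold jacobiWeight
  exact (continuous_id.rpow_const fun _ => .inr hα.le).mul
    ((continuous_const.sub continuous_id).rpow_const fun _ => .inr hβ.le)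

theorem intervalIntegrable_jacobiWeight_div {α β : ℝ} (hα : 0 < α) (hβ : 0 < β) :
    IntervalIntegrable (fun x => jacobiWeight α β x / x) volume 0 1 := by
  have h : IntervalIntegrable (fun x : ℝ => x ^ (α - 1) * (1 - x) ^ β) volume 0 1 :=
    (intervalIntegral.intervalIntegrable_rpow' (by linarith)).mul_continuousOn
      ((continuous_const.sub continuous_id).rpow_const fun _ => .inr hβ.le).continuousOn
  refine h.congr_uIoo fun x hx => ?_
  rw [Set.uIoo_of_le zero_le_one] at hx
  simp only [jacobiWeight]
  rw [Real.rpow_sub_one hx.1.ne']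
  ring

theorem jacobiWeight_one_sub (α β x : ℝ) : jacobiWeight α β (1 - x) = jacobiWeight β α x := by
  simp only [jacobiWeight, sub_sub_cancel, mul_comm]

theorem intervalIntegrable_jacobiWeight_div_one_sub {α β : ℝ} (hα : 0 < α) (hβ : 0 < β) :
    IntervalIntegrable (fun x => jacobiWeight α β x / (1 - x)) volume 0 1 := by
  have h := ((intervalIntegrable_jacobiWeight_div hβ hα).comp_sub_left 1).symm
  simpa only [jacobiWeight_one_sub, sub_zero, sub_self] using h

/-- The derivative of `q * jacobiWeight α β` on `(0, 1)`. -/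
noncomputable def jacobiDeriv (α β : ℝ) (q : ℝ[X]) (x : ℝ) : ℝ :=
  q.derivative.eval x * jacobiWeight α β x + α * (q.eval x * (jacobiWeight α β x / x))
    - β * (q.eval x * (jacobiWeight α β x / (1 - x)))

theorem intervalIntegrable_jacobiDeriv {α β : ℝ} (hα : 0 < α) (hβ : 0 < β) (q : ℝ[X]) :
    IntervalIntegrable (jacobiDeriv α β q) volume 0 1 :=
  (((q.derivative.continuous.mul (continuous_jacobiWeight hα hβ)).intervalIntegrable _ _).add
    (((intervalIntegrable_jacobiWeight_div hα hβ).continuousOn_mul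
      q.continuous.continuousOn).const_mul α)).sub
    (((intervalIntegrable_jacobiWeight_div_one_sub hα hβ).continuousOn_mul
      q.continuous.continuousOn).const_mul β)

theorem hasDerivAt_eval_mul_jacobiWeight (α β : ℝ) (q : ℝ[X]) {x : ℝ}
    (hx : x ∈ Set.Ioo (0 : ℝ) 1) :
    HasDerivAt (fun y => q.eval y * jacobiWeight α β y) (jacobiDeriv α β q x) x := by
  have h0 : x ≠ 0 := hx.1.ne'
  have h1 : 1 - x ≠ 0 := (sub_pos.2 hx.2).ne'
  have hl := Real.hasDerivAt_rpow_const (p := α) (Or.inl h0)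
  have hr := ((hasDerivAt_id x).const_sub 1).rpow_const (p := β) (Or.inl h1)
  refine ((q.hasDerivAt x).mul (hl.mul hr)).congr_deriv ?_
  simp only [jacobiDeriv, jacobiWeight, id_eq, Pi.mul_apply, Real.rpow_sub_one h0, Real.rpow_sub_one h1]
  ring

theorem integral_jacobiWeight_mul_eq {α β : ℝ} (hα : 0 < α) (hβ : 0 < β) {g G : ℝ → ℝ}
    (hg : Continuous g) (hG : ∀ u, HasDerivAt G (g u) u) (q : ℝ[X]) (s : ℝ) :
    ∫ x in (0 : ℝ)..1, q.eval x * jacobiWeight α β x * g (x - s)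
      = -∫ x in (0 : ℝ)..1, jacobiDeriv α β q x * G (x - s) := by
  have hGc : Continuous G := continuous_iff_continuousAt.2 fun u => (hG u).continuousAt
  have hsub : Continuous fun x : ℝ => x - s := continuous_id.sub continuous_const
  rw [intervalIntegral.integral_mul_deriv_eq_deriv_mul_of_hasDerivAt
    (u := fun x => q.eval x * jacobiWeight α β x) (v' := fun x => g (x - s)) (v := fun x => G (x - s))
    (q.continuous.mul (continuous_jacobiWeight hα hβ)).continuousOn
    (hGc.comp hsub).continuousOn
    (u' := jacobiDeriv α β q)
    (fun x hx => hasDerivAt_eval_mul_jacobiWeight α β q (by simpa using hx))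
    (fun x _ => by simpa using (hG (x - s)).comp_sub_const x s)
    (intervalIntegrable_jacobiDeriv hα hβ q)
    ((hg.comp hsub).intervalIntegrable _ _)]
  simp [jacobiWeight, Real.zero_rpow hα.ne', Real.zero_rpow hβ.ne']

theorem hasDerivAt_integral_jacobiWeight_mul {α β : ℝ} (hα : 0 < α) (hβ : 0 < β) {g G : ℝ → ℝ}
    (hg : Continuous g) (hG : ∀ u, HasDerivAt G (g u) u) (q : ℝ[X]) {t : ℝ}
    (ht : t ∈ Set.Ioo (0 : ℝ) 1) :
    HasDerivAt (fun s => ∫ x in (0 : ℝ)..1, q.eval x * jacobiWeight α β x * g (x - s))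
      (∫ x in (0 : ℝ)..1, jacobiDeriv α β q x * g (x - t)) t := by
  have hGc : Continuous G := continuous_iff_continuousAt.2 fun u => (hG u).continuousAt
  have hsub (s : ℝ) : Continuous fun x : ℝ => x - s := continuous_id.sub continuous_const
  have hJ := intervalIntegrable_jacobiDeriv hα hβ q
  obtain ⟨K, hK⟩ := (isCompact_Icc (a := (-1 : ℝ)) (b := 1)).exists_bound_of_continuousOn
    hg.continuousOn
  have hint (f : ℝ → ℝ) (hf : Continuous f) (s : ℝ) :
      IntervalIntegrable (fun x => jacobiDeriv α β q x * f (x - s)) volume 0 1 :=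
    hJ.mul_continuousOn (hf.comp (hsub s)).continuousOn
  have hder := (intervalIntegral.hasDerivAt_integral_of_dominated_loc_of_deriv_le
    (μ := volume) (a := 0) (b := 1)
    (F := fun s x => jacobiDeriv α β q x * G (x - s))
    (F' := fun s x => -(jacobiDeriv α β q x * g (x - s)))
    (bound := fun x => ‖jacobiDeriv α β q x‖ * K)
    (isOpen_Ioo.mem_nhds ht)
    (.of_forall fun s => (hint G hGc s).def'.aestronglyMeasurable)
    (hint G hGc t) (hint g hg t).neg.def'.aestronglyMeasurable
    (.of_forall fun x hx s hs => by
      rw [Set.uIoc_of_le zero_le_one] at hx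
      rw [norm_neg, norm_mul]
      refine mul_le_mul_of_nonneg_left (hK _ ⟨?_, ?_⟩) (norm_nonneg _)
      · linarith [hx.1, hs.2]
      · linarith [hx.2, hs.1])
    (hJ.norm.mul_const K)
    (.of_forall fun x _ s _ => by
      simpa using ((hG (x - s)).comp_const_sub x s).const_mul (jacobiDeriv α β q x))).2.neg
  simp_rw [integral_jacobiWeight_mul_eq hα hβ hg hG]
  rw [intervalIntegral.integral_neg, neg_neg] at hder
  exact hder

/-- The factor `|u| ^ γ` with a jump in its coefficient at `0`. -/
noncomputable def jumpPower (γ A B u : ℝ) : ℝ :=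
  |u| ^ γ * (A + B * (if 0 < u then (1 : ℝ) else 0))

theorem continuous_jumpPower {γ : ℝ} (hγ : 0 < γ) (A B : ℝ) : Continuous (jumpPower γ A B) := by
  have h : jumpPower γ A B = fun u => A * |u| ^ γ + B * (max u 0) ^ γ := by
    ext u
    rcases lt_or_ge 0 u with hu | hu
    · simp [jumpPower, hu, abs_of_pos hu, max_eq_left hu.le]
      ring
    · simp [jumpPower, hu.not_gt, max_eq_right hu, Real.zero_rpow hγ.ne']
      ring
  rw [h]
  exact (continuous_const.mul (continuous_abs.rpow_const fun _ => .inr hγ.le)).add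
    (continuous_const.mul ((continuous_id.max continuous_const).rpow_const fun _ => .inr hγ.le))

theorem hasDerivAt_mul_jumpPower {γ : ℝ} (hγ : 0 < γ) (A B u : ℝ) :
    HasDerivAt (fun v => v * jumpPower γ A B v / (γ + 1)) (jumpPower γ A B u) u := by
  have hc := continuous_jumpPower hγ A B
  have hγ1 : γ + 1 ≠ 0 := by positivity
  refine hasDerivAt_of_hasDerivAt_of_ne' (x := 0) (fun v hv => ?_)
    ((continuous_id.mul hc).div_const _).continuousAt hc.continuousAt u
  rcases hv.lt_or_gt with hv | hv
  · have hd := ((((hasDerivAt_id v).neg.rpow_const (p := γ + 1)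
      (Or.inl (neg_pos.2 hv).ne')).const_mul (-A)).div_const (γ + 1))
    refine (hd.congr_of_eventuallyEq ?_).congr_deriv ?_
    · filter_upwards [gt_mem_nhds hv] with y hy
      simp [jumpPower, hy.le.not_gt, abs_of_neg hy, Real.rpow_add_one (neg_pos.2 hy).ne']
      ring
    · simp [jumpPower, hv.le.not_gt, abs_of_neg hv]
      field_simp
      ring
  · have hd := (((Real.hasDerivAt_rpow_const (p := γ + 1)
      (Or.inl hv.ne')).const_mul (A + B)).div_const (γ + 1))
    refine (hd.congr_of_eventuallyEq ?_).congr_deriv ?_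
    · filter_upwards [lt_mem_nhds hv] with y hy
      simp [jumpPower, hy, abs_of_pos hy, Real.rpow_add_one hy.ne']
      ring
    · simp [jumpPower, hv, abs_of_pos hv]
      field_simp

theorem intervalIntegrable_eval_mul_div {α β : ℝ} (hα : 0 < α) (hβ : 0 < β) {g : ℝ → ℝ}
    (hg : Continuous g) (q : ℝ[X]) :
    IntervalIntegrable (fun x => q.eval x * (jacobiWeight α β x * g x) / x) volume 0 1 :=
  ((intervalIntegrable_jacobiWeight_div hα hβ).mul_continuousOn
    (q.continuous.mul hg).continuousOn).congr_uIoo fun x _ => by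
      simp only [Pi.mul_apply]
      ring

theorem intervalIntegrable_eval_mul_div_one_sub {α β : ℝ} (hα : 0 < α) (hβ : 0 < β) {g : ℝ → ℝ}
    (hg : Continuous g) (q : ℝ[X]) :
    IntervalIntegrable (fun x => q.eval x * (jacobiWeight α β x * g x) / (1 - x)) volume 0 1 :=
  ((intervalIntegrable_jacobiWeight_div_one_sub hα hβ).mul_continuousOn
    (q.continuous.mul hg).continuousOn).congr_uIoo fun x _ => by
      simp only [Pi.mul_apply]
      ring

theorem integral_jacobiDeriv_mul {α β : ℝ} (hα : 0 < α) (hβ : 0 < β) {g : ℝ → ℝ}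
    (hg : Continuous g) (q : ℝ[X]) :
    ∫ x in (0 : ℝ)..1, jacobiDeriv α β q x * g x
      = (∫ x in (0 : ℝ)..1, q.derivative.eval x * (jacobiWeight α β x * g x))
        + α * (∫ x in (0 : ℝ)..1, q.eval x * (jacobiWeight α β x * g x) / x)
        - β * ∫ x in (0 : ℝ)..1, q.eval x * (jacobiWeight α β x * g x) / (1 - x) := by
  have h₁ : IntervalIntegrable (fun x => q.derivative.eval x * (jacobiWeight α β x * g x))
      volume 0 1 := (q.derivative.continuous.mul
    ((continuous_jacobiWeight hα hβ).mul hg)).intervalIntegrable _ _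
  have h₂ : IntervalIntegrable (fun x => q.eval x * (jacobiWeight α β x * g x) / x)
      volume 0 1 :=
    intervalIntegrable_eval_mul_div hα hβ hg q
  have h₃ : IntervalIntegrable (fun x => q.eval x * (jacobiWeight α β x * g x) / (1 - x))
      volume 0 1 :=
    intervalIntegrable_eval_mul_div_one_sub hα hβ hg q
  rw [← intervalIntegral.integral_const_mul, ← intervalIntegral.integral_const_mul,
    ← intervalIntegral.integral_add h₁ (h₂.const_mul α),
    ← intervalIntegral.integral_sub (h₁.add (h₂.const_mul α)) (h₃.const_mul β)]
  refine intervalIntegral.integral_congr fun x _ => ?_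
  simp only [jacobiDeriv]
  ring

/-- Integrate by parts against `(x - t) g(x - t)`, using that `g` is homogeneous of degree `γ`. -/
theorem integral_derivative_mul_jacobiWeight_mul_jumpPower {α β γ : ℝ} (hα : 0 < α) (hβ : 0 < β)
    (hγ : 0 < γ) (A B : ℝ) (q : ℝ[X]) (t : ℝ) :
    (∫ x in (0 : ℝ)..1,
        ((X - C t) * q.derivative).eval x * (jacobiWeight α β x * jumpPower γ A B (x - t)))
      + (α + β + γ + 1) *
        (∫ x in (0 : ℝ)..1, q.eval x * (jacobiWeight α β x * jumpPower γ A B (x - t)))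
      = t * (α * ∫ x in (0 : ℝ)..1,
          q.eval x * (jacobiWeight α β x * jumpPower γ A B (x - t)) / x)
        + (1 - t) * (β * ∫ x in (0 : ℝ)..1,
          q.eval x * (jacobiWeight α β x * jumpPower γ A B (x - t)) / (1 - x)) := by
  have hg : Continuous fun x => jumpPower γ A B (x - t) :=
    (continuous_jumpPower hγ A B).comp (continuous_id.sub continuous_const)
  have hw := (continuous_jacobiWeight hα hβ).mul hg
  have hparts := integral_jacobiWeight_mul_eq hα hβ (continuous_jumpPower hγ A B)
    (hasDerivAt_mul_jumpPower hγ A B) q t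
  have hγ1 : γ + 1 ≠ 0 := by positivity
  have hscale : (γ + 1) * (∫ x in (0 : ℝ)..1,
        q.eval x * (jacobiWeight α β x * jumpPower γ A B (x - t)))
      + ∫ x in (0 : ℝ)..1, jacobiDeriv α β q x * ((x - t) * jumpPower γ A B (x - t)) = 0 := by
    have h₁ : (∫ x in (0 : ℝ)..1, jacobiDeriv α β q x * ((x - t) * jumpPower γ A B (x - t)))
        = (γ + 1) * ∫ x in (0 : ℝ)..1,
          jacobiDeriv α β q x * ((x - t) * jumpPower γ A B (x - t) / (γ + 1)) := by
      rw [← intervalIntegral.integral_const_mul]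
      refine intervalIntegral.integral_congr fun x _ => ?_
      field_simp
    simp only [mul_assoc] at hparts h₁ ⊢
    rw [h₁, hparts, mul_neg, neg_add_cancel]
  have h₁ : IntervalIntegrable (fun x => ((X - C t) * q.derivative).eval x *
      (jacobiWeight α β x * jumpPower γ A B (x - t))) volume 0 1 :=
    ((Polynomial.continuous _).mul hw).intervalIntegrable _ _
  have h₀ : IntervalIntegrable (fun x => q.eval x *
      (jacobiWeight α β x * jumpPower γ A B (x - t))) volume 0 1 :=
    (q.continuous.mul hw).intervalIntegrable _ _
  have h₂ : IntervalIntegrable (fun x => q.eval x *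
      (jacobiWeight α β x * jumpPower γ A B (x - t)) / x) volume 0 1 :=
    intervalIntegrable_eval_mul_div hα hβ hg q
  have h₃ : IntervalIntegrable (fun x => q.eval x *
      (jacobiWeight α β x * jumpPower γ A B (x - t)) / (1 - x)) volume 0 1 :=
    intervalIntegrable_eval_mul_div_one_sub hα hβ hg q
  have hsplit : (∫ x in (0 : ℝ)..1,
      jacobiDeriv α β q x * ((x - t) * jumpPower γ A B (x - t)))
      = ∫ x in (0 : ℝ)..1, (((X - C t) * q.derivative).eval x *
          (jacobiWeight α β x * jumpPower γ A B (x - t))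
        + (α + β) * (q.eval x * (jacobiWeight α β x * jumpPower γ A B (x - t)))
        - (t * α) * (q.eval x * (jacobiWeight α β x * jumpPower γ A B (x - t)) / x)
        - ((1 - t) * β) *
          (q.eval x * (jacobiWeight α β x * jumpPower γ A B (x - t)) / (1 - x))) := by
    refine intervalIntegral.integral_congr_Ioo_of_le zero_le_one fun x hx => ?_
    have hx0 : x ≠ 0 := hx.1.ne'
    have hx1 : 1 - x ≠ 0 := (sub_pos.2 hx.2).ne'
    simp only [jacobiDeriv, eval_mul, eval_sub, eval_X, eval_C]
    field_simp
    ring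
  rw [intervalIntegral.integral_sub
      ((h₁.add (h₀.const_mul _)).sub (h₂.const_mul _)) (h₃.const_mul _),
    intervalIntegral.integral_sub (h₁.add (h₀.const_mul _)) (h₂.const_mul _),
    intervalIntegral.integral_add h₁ (h₀.const_mul _)] at hsplit
  simp only [intervalIntegral.integral_const_mul] at hsplit
  linarith

/-- Integration against a continuous weight, as a linear functional on polynomials. -/
noncomputable def weightFunctional (v : ℝ → ℝ) (hv : Continuous v) : ℝ[X] →ₗ[ℝ] ℝ where
  toFun q := ∫ x in (0 : ℝ)..1, q.eval x * v x
  map_add' p q := by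
    simp only [eval_add, add_mul]
    exact intervalIntegral.integral_add ((p.continuous.mul hv).intervalIntegrable _ _)
      ((q.continuous.mul hv).intervalIntegrable _ _)
  map_smul' c q := by
    simp only [eval_smul, smul_eq_mul, mul_assoc, intervalIntegral.integral_const_mul,
      RingHom.id_apply]

theorem degree_X_mul_derivative_sub_lt {p : ℝ[X]} {n : ℕ} (hp : p.natDegree = n) :
    (X * derivative p - C (n : ℝ) * p).degree < (n : WithBot ℕ) := by
  rw [degree_lt_iff_coeff_zero]
  intro m hm
  rcases m with _ | m
  · simp [Nat.le_zero.1 hm]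
  · rw [coeff_sub, coeff_X_mul, coeff_derivative, coeff_C_mul]
    rcases hm.eq_or_lt with rfl | hm
    · push_cast
      ring
    · rw [coeff_eq_zero_of_natDegree_lt (hp.trans_lt hm)]
      ring

theorem degree_derivative_lt_of_natDegree {p : ℝ[X]} {n : ℕ} (hp : p.Monic)
    (hn : p.natDegree = n) : (derivative p).degree < (n : WithBot ℕ) := by
  rw [← hn, ← degree_eq_natDegree hp.ne_zero]
  exact degree_derivative_lt hp.ne_zero

/-- The logarithmic derivative of the squared norm `h_n(t)` satisfies
`t (ln h_n)'(t) = t x_n − t R_n = α + β + γ + 2n + 1 − R_n`. -/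
theorem log_deriv_hn (α β γ A B : ℝ)
    (hα : 0 < α) (hβ : 0 < β) (hγ : 0 < γ)
    (hA : 0 ≤ A) (hAB : 0 ≤ A + B)
    (w : ℝ → ℝ → ℝ)
    (hw : ∀ t x, w t x = x ^ α * (1 - x) ^ β * |x - t| ^ γ *
      (A + B * (if t < x then (1 : ℝ) else 0)))
    (P : ℕ → ℝ → Polynomial ℝ) (h : ℕ → ℝ → ℝ)
    (hmonic : ∀ n, ∀ t ∈ Set.Ioo (0 : ℝ) 1, (P n t).Monic)
    (hdeg : ∀ n, ∀ t ∈ Set.Ioo (0 : ℝ) 1, (P n t).natDegree = n)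
    (horth : ∀ m n, ∀ t ∈ Set.Ioo (0 : ℝ) 1,
      (∫ x in (0 : ℝ)..1, (P m t).eval x * (P n t).eval x * w t x)
        = if m = n then h n t else 0)
    (hpos : ∀ n, ∀ t ∈ Set.Ioo (0 : ℝ) 1, 0 < h n t)
    (n : ℕ) (t : ℝ) (ht : t ∈ Set.Ioo (0 : ℝ) 1) :
    t * deriv (fun s => Real.log (h n s)) t
      = t * ((α / h n t) * ∫ y in (0 : ℝ)..1, ((P n t).eval y) ^ 2 * w t y / y)
        - t * ((β / h n t) * ∫ y in (0 : ℝ)..1, ((P n t).eval y) ^ 2 * w t y / (1 - y)) ∧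
    t * deriv (fun s => Real.log (h n s)) t
      = α + β + γ + 2 * n + 1
        - (β / h n t) * ∫ y in (0 : ℝ)..1, ((P n t).eval y) ^ 2 * w t y / (1 - y) := by
  have hgc := continuous_jumpPower hγ A B
  have hv (s : ℝ) : Continuous fun x => jacobiWeight α β x * jumpPower γ A B (x - s) :=
    (continuous_jacobiWeight hα hβ).mul (hgc.comp (continuous_id.sub continuous_const))
  have hwv (s x : ℝ) : w s x = jacobiWeight α β x * jumpPower γ A B (x - s) := by
    simp only [hw, jacobiWeight, jumpPower, sub_pos, mul_assoc]
  let L : ℝ → ℝ[X] →ₗ[ℝ] ℝ := fun s => weightFunctional _ (hv s)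
  have hLapp (s : ℝ) (q : ℝ[X]) : L s q
      = ∫ x in (0 : ℝ)..1, q.eval x * (jacobiWeight α β x * jumpPower γ A B (x - s)) := rfl
  have hL (q : ℝ[X]) : ∀ s ∈ Set.Ioo (0 : ℝ) 1, HasDerivAt (fun s => L s q)
      (∫ x in (0 : ℝ)..1, jacobiDeriv α β q x * jumpPower γ A B (x - s)) s := by
    intro s hs
    simpa only [hLapp, mul_assoc] using hasDerivAt_integral_jacobiWeight_mul hα hβ hgc
      (hasDerivAt_mul_jumpPower hγ A B) q hs
  have hLorth : ∀ m n, ∀ s ∈ Set.Ioo (0 : ℝ) 1,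
      L s (P m s * P n s) = if m = n then h n s else 0 := by
    intro m n s hs
    rw [← horth m n s hs, hLapp]
    simp only [eval_mul, hwv]
  have hne : ∀ n, ∀ s ∈ Set.Ioo (0 : ℝ) 1, h n s ≠ 0 := fun n s hs => (hpos n s hs).ne'
  have hder := hasDerivAt_norm_of_orthogonal L _ P h isOpen_Ioo hL hmonic hdeg hLorth hne n ht
  have hlow (q : ℝ[X]) (hq : q.degree < n) : L t (q * P n t) = 0 :=
    map_mul_eq_zero_of_orthogonal (L t) (fun k => P k t) (fun k => h k t)
      (fun k => hmonic k t ht) (fun k => hdeg k t ht) (fun m k => hLorth m k t ht)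
      (fun k => hne k t ht) n q hq
  have hnorm : L t (P n t * P n t) = h n t := by rw [hLorth n n t ht, if_pos rfl]
  have hd0 : L t (derivative (P n t) * P n t) = 0 :=
    hlow _ (degree_derivative_lt_of_natDegree (hmonic n t ht) (hdeg n t ht))
  have hdX : L t (X * derivative (P n t) * P n t) = n * h n t := by
    have := hlow _ (degree_X_mul_derivative_sub_lt (hdeg n t ht))
    rw [sub_mul, map_sub, mul_assoc (C _), C_mul', map_smul, hnorm, smul_eq_mul] at this
    linarith
  have hderiv0 : L t (derivative (P n t * P n t)) = 0 := by
    rw [derivative_mul, map_add, mul_comm (P n t), hd0, add_zero]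
  have hderivX : L t ((X - C t) * derivative (P n t * P n t)) = 2 * n * h n t := by
    have : (X - C t) * derivative (P n t * P n t)
        = (2 : ℝ) • (X * derivative (P n t) * P n t)
          - (2 * t) • (derivative (P n t) * P n t) := by
      rw [derivative_mul, smul_eq_C_mul, smul_eq_C_mul, C_mul, C_ofNat]
      ring
    rw [this, map_sub, map_smul, map_smul, hd0, hdX, smul_eq_mul, smul_eq_mul]
    ring
  have hsum := integral_derivative_mul_jacobiWeight_mul_jumpPower hα hβ hγ A B
    (P n t * P n t) t
  rw [← hLapp, ← hLapp, hderivX, hnorm] at hsum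
  rw [integral_jacobiDeriv_mul hα hβ (g := fun x => jumpPower γ A B (x - t))
      (hgc.comp (continuous_id.sub continuous_const)),
    ← hLapp, hderiv0] at hder
  simp only [hwv, (hder.log (hne n t ht)).deriv]
  simp only [← pow_two, eval_pow] at hsum ⊢
  generalize (∫ y in (0 : ℝ)..1, (P n t).eval y ^ 2 *
    (jacobiWeight α β y * jumpPower γ A B (y - t)) / y) = a at hsum ⊢
  generalize (∫ y in (0 : ℝ)..1, (P n t).eval y ^ 2 *
    (jacobiWeight α β y * jumpPower γ A B (y - t)) / (1 - y)) = b at hsum ⊢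
  have hn0 := hne n t ht
  constructor
  · field_simp
    ring
  · field_simp
    linarith
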